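/- arXiv:alg-geom/9705013 — 2 statements merged into one kernel-verified Lean document; each statement's English description precedes it below -/
import Mathlib

section
/- Let I ⊆ ℕ and v ∈ S_∞. There exists an I-chain from the identity e to v if and only if v is the element of minimal length in its coset vW_{Ī} (equivalently, every descent of v lies in I: v(i) < v(i+1) for all i ∉ I). -/
/-- A permutation of the positive integers belongs to `S_∞` when it moves only
finitely many points. -/
def FinSupp (w : Equiv.Perm ℕ+) : Prop := {x : ℕ+ | w x ≠ x}.Finite

/-- The length `ℓ(w)` of a permutation: its number of inversions. -/
noncomputable def len (w : Equiv.Perm ℕ+) : ℕ :=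
  Set.ncard {p : ℕ+ × ℕ+ | p.1 < p.2 ∧ w p.2 < w p.1}

/-- A step of an `I`-chain: a cover `u ⋖ u(a,b)` in the Bruhat order
(`a < b` and `ℓ(u(a,b)) = ℓ(u) + 1`) which admits a colour `i ∈ I` with
`a ≤ i < b`. -/
def IChainCov (I : Set ℕ+) (u w : Equiv.Perm ℕ+) : Prop :=
  ∃ a b : ℕ+, a < b ∧ w = u * Equiv.swap a b ∧ len w = len u + 1 ∧
    ∃ i ∈ I, a ≤ i ∧ i < b

/-- There is an `I`-chain from `u` to `w`: a saturated chain of Bruhat covers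
from `u` to `w`, each of whose covers can be assigned a colour from `I`. -/
def IChainLE (I : Set ℕ+) : Equiv.Perm ℕ+ → Equiv.Perm ℕ+ → Prop :=
  Relation.ReflTransGen (IChainCov I)

/-- The set of inversions of a permutation. -/
def inversions (w : Equiv.Perm ℕ+) : Set (ℕ+ × ℕ+) :=
  {p : ℕ+ × ℕ+ | p.1 < p.2 ∧ w p.2 < w p.1}

theorem len_eq_ncard_inversions (w : Equiv.Perm ℕ+) : len w = (inversions w).ncard := rfl

theorem FinSupp.one : FinSupp 1 := by
  simp [FinSupp]

theorem FinSupp.mul_swap {u : Equiv.Perm ℕ+} (hu : FinSupp u) (a b : ℕ+) :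
    FinSupp (u * Equiv.swap a b) := by
  refine (hu.union (Set.toFinite {a, b})).subset fun x hx => ?_
  by_contra h
  simp only [Set.mem_union, Set.mem_ofPred_eq, Set.mem_insert_iff, Set.mem_singleton_iff,
    not_or, not_not] at h
  exact hx (by simp [Equiv.swap_apply_of_ne_of_ne h.2.1 h.2.2, h.1])

theorem FinSupp.finite_inversions {u : Equiv.Perm ℕ+} (hu : FinSupp u) :
    (inversions u).Finite := by
  obtain ⟨N, hN⟩ := hu.bddAbove
  have hfix : ∀ x, N < x → u x = x := fun x hx => by
    by_contra h
    exact absurd (hN h) (not_le.mpr hx)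
  refine ((Set.finite_Iic N).prod (Set.finite_Iic N)).subset ?_
  rintro ⟨p, q⟩ ⟨hpq, hinv⟩
  dsimp only at hpq hinv
  have hq : q ≤ N := by
    by_contra! hq
    rw [hfix q hq] at hinv
    have hp : u p = p := u.injective (hfix (u p) (hq.trans hinv))
    rw [hp] at hinv
    exact lt_asymm hpq hinv
  exact ⟨hpq.le.trans hq, hq⟩

/-- Apply `(a,b)` to both entries of a pair, unless this would reverse their order. -/
def swapPair (a b : ℕ+) (p : ℕ+ × ℕ+) : ℕ+ × ℕ+ :=
  if Equiv.swap a b p.1 < Equiv.swap a b p.2 then (Equiv.swap a b p.1, Equiv.swap a b p.2) else p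

theorem swapPair_injOn (a b : ℕ+) : Set.InjOn (swapPair a b) {p | p.1 < p.2} := by
  have key : ∀ p ∈ {p : ℕ+ × ℕ+ | p.1 < p.2}, swapPair a b (swapPair a b p) = p := by
    rintro ⟨p, q⟩ (h : p < q)
    by_cases hs : Equiv.swap a b p < Equiv.swap a b q <;> simp [swapPair, hs, h]
  intro p hp q hq h
  rw [← key p hp, h, key q hq]

theorem ncard_swapPair_image (u : Equiv.Perm ℕ+) (a b : ℕ+) :
    (swapPair a b '' inversions u).ncard = len u :=
  ((swapPair_injOn a b).mono fun _ hp => hp.1).ncard_image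

theorem swapPair_image_subset {u : Equiv.Perm ℕ+} {a b : ℕ+} (hab : a < b) (hu : u a < u b) :
    swapPair a b '' inversions u ⊆ inversions (u * Equiv.swap a b) := by
  rintro _ ⟨⟨p, q⟩, ⟨h1, h2⟩, rfl⟩
  dsimp only at h1 h2
  by_cases hs : Equiv.swap a b p < Equiv.swap a b q
  · simp [swapPair, hs, inversions, h2]
  · simp only [swapPair, hs, if_false, inversions, Set.mem_ofPred_eq, Equiv.Perm.mul_apply]
    refine ⟨h1, ?_⟩
    simp only [Equiv.swap_apply_def] at hs ⊢
    grind

theorem mem_inversions_mul_swap {u : Equiv.Perm ℕ+} {a b : ℕ+} (hab : a < b) (hu : u a < u b) :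
    (a, b) ∈ inversions (u * Equiv.swap a b) := by
  simp [inversions, hab, hu]

theorem notMem_swapPair_image {u : Equiv.Perm ℕ+} {a b c : ℕ+} (hac : a < c) (hcb : c ≤ b)
    (hu : u a < u c) : (a, c) ∉ swapPair a b '' inversions u := by
  rintro ⟨⟨p, q⟩, ⟨h1, h2⟩, h⟩
  dsimp only at h1 h2
  simp only [swapPair, Equiv.swap_apply_def] at h
  grind

theorem len_lt_len_mul_swap {u : Equiv.Perm ℕ+} (hfin : FinSupp u) {a b : ℕ+} (hab : a < b)
    (hu : u a < u b) : len u < len (u * Equiv.swap a b) := by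
  rw [← ncard_swapPair_image u a b, len_eq_ncard_inversions (u * Equiv.swap a b)]
  refine Set.ncard_lt_ncard ⟨swapPair_image_subset hab hu, fun h => ?_⟩
    (hfin.mul_swap a b).finite_inversions
  exact notMem_swapPair_image hab le_rfl hu (h (mem_inversions_mul_swap hab hu))

/-- The usual description of the covers of the Bruhat order. -/
theorem len_mul_swap_eq_add_one_iff {u : Equiv.Perm ℕ+} (hfin : FinSupp u) {a b : ℕ+}
    (hab : a < b) : len (u * Equiv.swap a b) = len u + 1 ↔
      u a < u b ∧ ∀ c, a < c → c < b → u a < u c → ¬ u c < u b := by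
  have hfinw := (hfin.mul_swap a b).finite_inversions
  have hfini := hfin.finite_inversions.image (swapPair a b)
  constructor
  · intro hlen
    have hu : u a < u b := by
      by_contra! hle
      have hlt : u b < u a := hle.lt_of_ne (u.injective.ne hab.ne')
      have := len_lt_len_mul_swap (hfin.mul_swap a b) hab (by simpa using hlt)
      rw [mul_assoc, Equiv.swap_mul_self, mul_one] at this
      omega
    refine ⟨hu, fun c hac hcb h1 h2 => ?_⟩
    have hsub : insert (a, c) (insert (a, b) (swapPair a b '' inversions u)) ⊆
        inversions (u * Equiv.swap a b) := by
      refine Set.insert_subset ?_ (Set.insert_subset (mem_inversions_mul_swap hab hu)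
        (swapPair_image_subset hab hu))
      simp [inversions, Equiv.swap_apply_of_ne_of_ne hac.ne' hcb.ne, hac, h2]
    have hcard := Set.ncard_le_ncard hsub hfinw
    rw [Set.ncard_insert_of_notMem _ (hfini.insert _),
      Set.ncard_insert_of_notMem (notMem_swapPair_image hab le_rfl hu) hfini,
      ncard_swapPair_image, ← len_eq_ncard_inversions] at hcard
    · omega
    · rintro (h | h)
      · exact hcb.ne (Prod.ext_iff.mp h).2
      · exact notMem_swapPair_image hac hcb.le h1 h
  · rintro ⟨hu, hno⟩
    have heq : inversions (u * Equiv.swap a b) =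
        insert (a, b) (swapPair a b '' inversions u) := by
      refine Set.Subset.antisymm ?_ (Set.insert_subset (mem_inversions_mul_swap hab hu)
        (swapPair_image_subset hab hu))
      rintro ⟨p, q⟩ ⟨h1, h2⟩
      simp only [Equiv.Perm.mul_apply] at h1 h2
      by_cases hs : Equiv.swap a b p < Equiv.swap a b q
      · exact Or.inr ⟨(Equiv.swap a b p, Equiv.swap a b q), ⟨hs, h2⟩, by simp [swapPair, h1]⟩
      by_cases hpq : p = a ∧ q = b
      · exact Or.inl (by rw [hpq.1, hpq.2])
      refine Or.inr ⟨(p, q), ⟨h1, ?_⟩, by simp [swapPair, hs]⟩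
      have hne : u p < u q ∨ u q < u p := lt_or_gt_of_ne (u.injective.ne h1.ne)
      have hp := hno p
      have hq := hno q
      have hpa := lt_trichotomy p a
      have hqb := lt_trichotomy q b
      simp only [Equiv.swap_apply_def] at hs h2 ⊢
      grind
    rw [len_eq_ncard_inversions, heq,
      Set.ncard_insert_of_notMem (notMem_swapPair_image hab le_rfl hu) hfini,
      ncard_swapPair_image]

theorem IChainCov.finSupp {I : Set ℕ+} {u w : Equiv.Perm ℕ+} (h : IChainCov I u w)
    (hu : FinSupp u) : FinSupp w := by
  obtain ⟨a, b, -, rfl, -⟩ := h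
  exact hu.mul_swap a b

theorem IChainCov.lt_add_one {I : Set ℕ+} {u w : Equiv.Perm ℕ+} (h : IChainCov I u w)
    (hfin : FinSupp u) (hu : ∀ i ∉ I, u i < u (i + 1)) : ∀ i ∉ I, w i < w (i + 1) := by
  obtain ⟨a, b, hab, rfl, hlen, j, hj, haj, hjb⟩ := h
  obtain ⟨hlt, hno⟩ := (len_mul_swap_eq_add_one_iff hfin hab).mp hlen
  intro i hi
  have hui := hu i hi
  have hsucc : i < i + 1 := PNat.lt_add_right i 1
  have hdisc : ∀ x, i < x → i + 1 ≤ x := fun x hx => PNat.add_one_le_iff.mpr hx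
  have hji : j ≠ i := fun h => hi (h ▸ hj)
  have htri : ∀ x y, x = y ∨ u x < u y ∨ u y < u x := fun x y =>
    or_iff_not_imp_left.mpr fun h => lt_or_gt_of_ne (u.injective.ne h)
  have h1 := hno i
  have h2 := hno (i + 1)
  have h3 := htri i a
  have h4 := htri (i + 1) b
  have h5 := hdisc j
  have h6 := hdisc b
  have h7 := lt_trichotomy i a
  have h8 := lt_trichotomy (i + 1) b
  have h9 := lt_trichotomy i j
  clear hno htri hdisc hu
  simp only [Equiv.Perm.mul_apply, Equiv.swap_apply_def]
  grind

theorem perm_eq_one_of_forall_lt_add_one {v : Equiv.Perm ℕ+} (h : ∀ i, v i < v (i + 1)) :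
    v = 1 := by
  have hmono : StrictMono v := strictMono_of_lt_add_one fun i _ => h i
  let f : ℕ+ ≃o ℕ+ := hmono.orderIsoOfSurjective v v.surjective
  have hf : f = OrderIso.refl ℕ+ := Subsingleton.elim _ _
  ext1 x
  exact congrArg (fun g : ℕ+ ≃o ℕ+ => g x) hf

/-- Among the inversions straddling a descent in `I`, one with the smallest difference of values
gives a cover below `v` that creates no descent outside `I`. -/
theorem exists_IChainCov {I : Set ℕ+} {v : Equiv.Perm ℕ+} (hfin : FinSupp v)
    (hv : ∀ i ∉ I, v i < v (i + 1)) (hne : v ≠ 1) :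
    ∃ u, FinSupp u ∧ (∀ i ∉ I, u i < u (i + 1)) ∧ IChainCov I u v := by
  obtain ⟨d, hd⟩ : ∃ d, ¬ v d < v (d + 1) := by
    by_contra! h
    exact hne (perm_eq_one_of_forall_lt_add_one h)
  have hdI : d ∈ I := by
    by_contra h
    exact hd (hv d h)
  have hsucc : ∀ i : ℕ+, i < i + 1 := fun i => PNat.lt_add_right i 1
  have hd' : v (d + 1) < v d := (not_lt.mp hd).lt_of_ne (v.injective.ne (hsucc d).ne')
  let S : Set (ℕ+ × ℕ+) := {p | p.1 ≤ d ∧ d < p.2 ∧ v p.2 < v p.1}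
  have hS : S.Nonempty := ⟨(d, d + 1), le_rfl, hsucc d, hd'⟩
  let gap : ℕ+ × ℕ+ → ℕ := fun p => (v p.1 : ℕ) - (v p.2 : ℕ)
  obtain ⟨⟨a, b⟩, ⟨had, hdb, hba⟩, hmin⟩ :=
    (measure gap).wf.has_min S hS
  dsimp only at had hdb hba
  have hleft : ∀ c, c ≤ d → v c < v a → v c ≤ v b := by
    intro c hc hca
    by_contra! h
    refine hmin (c, b) ⟨hc, hdb, h⟩ ?_
    change (v c : ℕ) - (v b : ℕ) < (v a : ℕ) - (v b : ℕ)
    rw [← PNat.coe_lt_coe] at hca h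
    omega
  have hright : ∀ c, d < c → v b < v c → v a ≤ v c := by
    intro c hc hca
    by_contra! h
    refine hmin (a, c) ⟨had, hc, h⟩ ?_
    change (v a : ℕ) - (v c : ℕ) < (v a : ℕ) - (v b : ℕ)
    rw [← PNat.coe_lt_coe] at hca h
    omega
  have hab : a < b := had.trans_lt hdb
  have hfinu := hfin.mul_swap a b
  have hvu : v = v * Equiv.swap a b * Equiv.swap a b := by
    rw [mul_assoc, Equiv.swap_mul_self, mul_one]
  refine ⟨v * Equiv.swap a b, hfinu, fun i hi => ?_, a, b, hab, hvu, ?_, d, hdI, had, hdb⟩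
  · have hvi := hv i hi
    have hs := hsucc i
    have hid : i ≠ d := fun h => hi (h ▸ hdI)
    have hdisc : ∀ x, i < x → i + 1 ≤ x := fun x hx => PNat.add_one_le_iff.mpr hx
    have h1 := hleft i
    have h2 := hright (i + 1)
    have h3 : v i = v b → i = b := fun h => v.injective h
    have h4 : v (i + 1) = v a → i + 1 = a := fun h => v.injective h
    have h5 := hdisc d
    have h6 := hdisc b
    simp only [Equiv.Perm.mul_apply, Equiv.swap_apply_def]
    grind
  · have hcov := (len_mul_swap_eq_add_one_iff hfinu hab).mpr
    rw [← hvu] at hcov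
    refine hcov ⟨by simpa using hba, fun c hac hcb h1 h2 => ?_⟩
    simp only [Equiv.Perm.mul_apply, Equiv.swap_apply_left, Equiv.swap_apply_right,
      Equiv.swap_apply_of_ne_of_ne hac.ne' hcb.ne] at h1 h2
    rcases le_or_gt c d with hc | hc
    · exact absurd h1 (not_lt.mpr (hleft c hc h2))
    · exact absurd h2 (not_lt.mpr (hright c hc h1))

/-- There is an `I`-chain from the identity `e` to `v` iff every descent of
`v` lies in `I`, i.e. `v(i) < v(i+1)` for all `i ∉ I` (equivalently, `v` is
the minimal-length element of its coset `v·W_Ī`). -/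
theorem stmt_1 (I : Set ℕ+) (v : Equiv.Perm ℕ+) (hv : FinSupp v) :
    IChainLE I 1 v ↔ ∀ i : ℕ+, i ∉ I → v i < v (i + 1) := by
  constructor
  · intro h
    suffices FinSupp v ∧ ∀ i ∉ I, v i < v (i + 1) from this.2
    clear hv
    induction h with
    | refl => exact ⟨FinSupp.one, fun i _ => PNat.lt_add_right i 1⟩
    | tail _ hcov ih => exact ⟨hcov.finSupp ih.1, hcov.lt_add_one ih.1 ih.2⟩
  · intro h
    induction hn : len v using Nat.strong_induction_on generalizing v with
    | _ n ih =>
      by_cases hne : v = 1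
      · rw [hne]
        exact Relation.ReflTransGen.refl
      obtain ⟨u, hfin, hu, hcov⟩ := exists_IChainCov hv h hne
      have hlen : len v = len u + 1 := by
        obtain ⟨a, b, -, -, hlen, -⟩ := hcov
        exact hlen
      exact (ih (len u) (by omega) u hfin hu rfl).tail hcov
end

section
/- For every ζ ∈ S_∞ there exist u ∈ S_∞ and k ∈ ℕ such that u ≤_k ζu in the k-Bruhat order. -/
/-- Covering relation of the `k`-Bruhat order: `u ⋖_k u(a,b)` for `a ≤ k < b`
with `ℓ(u(a,b)) = ℓ(u) + 1`.  Here `u(a,b) = u * (swap a b)`. -/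
def kBruhatCov (k : ℕ+) (u w : Equiv.Perm ℕ+) : Prop :=
  ∃ a b : ℕ+, a ≤ k ∧ k < b ∧ w = u * Equiv.swap a b ∧ len w = len u + 1

/-- The `k`-Bruhat order `u ≤_k w`: a chain of `k`-Bruhat covers from `u` to `w`
(or `u = w`). -/
def kBruhat (k : ℕ+) : Equiv.Perm ℕ+ → Equiv.Perm ℕ+ → Prop :=
  Relation.ReflTransGen (kBruhatCov k)

theorem FinSupp.mul {v w : Equiv.Perm ℕ+} (hv : FinSupp v) (hw : FinSupp w) : FinSupp (v * w) := by
  refine (hv.union hw).subset fun x hx => ?_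
  by_contra h
  simp only [Set.mem_union, Set.mem_ofPred_eq, not_or, not_not] at h hx
  exact hx (by rw [Equiv.Perm.mul_apply, h.2, h.1])

theorem FinSupp.inv {w : Equiv.Perm ℕ+} (hw : FinSupp w) : FinSupp w⁻¹ := by
  refine hw.subset fun x hx h => hx ?_
  rw [Equiv.Perm.inv_eq_iff_eq, h]

theorem FinSupp.swap (a b : ℕ+) : FinSupp (Equiv.swap a b) := by
  refine (Set.toFinite {a, b}).subset fun x hx => ?_
  by_contra h
  simp only [Set.mem_insert_iff, Set.mem_singleton_iff, not_or] at h
  exact hx (Equiv.swap_apply_of_ne_of_ne h.1 h.2)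

theorem FinSupp.finite_ne {u w : Equiv.Perm ℕ+} (hu : FinSupp u) (hw : FinSupp w) :
    {x | u x ≠ w x}.Finite := by
  refine (hu.union hw).subset fun x hx => ?_
  by_contra h
  simp only [Set.mem_union, Set.mem_ofPred_eq, not_or, not_not] at h hx
  exact hx (h.1.trans h.2.symm)

theorem FinSupp.finite_inversions_s8 {w : Equiv.Perm ℕ+} (hw : FinSupp w) :
    {p : ℕ+ × ℕ+ | p.1 < p.2 ∧ w p.2 < w p.1}.Finite := by
  obtain ⟨N, hN⟩ := hw.bddAbove
  have hfix : ∀ x, N < x → w x = x := fun x hx => by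
    by_contra h
    exact absurd (hN h) (not_le.2 hx)
  refine ((Set.finite_Iic N).prod (Set.finite_Iic N)).subset ?_
  rintro ⟨x, y⟩ ⟨hxy, hw'⟩
  simp only at hxy hw'
  have hy : y ≤ N := by
    by_contra! h
    rw [hfix y h] at hw'
    have := w.injective (hfix (w x) (h.trans hw'))
    rw [this] at hw'
    exact lt_asymm hxy hw'
  exact ⟨hxy.le.trans hy, hy⟩

/-- Exchanging the values at `a < b`, when no value in between occurs at a position in between,
creates exactly one inversion. -/
theorem len_mul_swap {v : Equiv.Perm ℕ+} (hv : FinSupp v) {a b : ℕ+} (hab : a < b)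
    (hlt : v a < v b) (hcov : ∀ c, a < c → c < b → ¬ (v a < v c ∧ v c < v b)) :
    len (v * Equiv.swap a b) = len v + 1 := by
  let τ := Equiv.swap a b
  let φ : ℕ+ × ℕ+ → ℕ+ × ℕ+ := fun p => if τ p.1 < τ p.2 then (τ p.1, τ p.2) else p
  have hττ : ∀ x, τ (τ x) = x := fun x => Equiv.swap_apply_self a b x
  have hφφ : ∀ p : ℕ+ × ℕ+, p.1 < p.2 → φ (φ p) = p := by
    rintro ⟨x, y⟩ h
    by_cases h' : τ x < τ y
    · simp [φ, h', hττ, show x < y from h]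
    · simp [φ, h']
  have hτ : ∀ x, τ x = if x = a then b else if x = b then a else x :=
    fun x => Equiv.swap_apply_def a b x
  have hinj : ∀ x y, v x = v y → x = y := fun x y h => v.injective h
  have hset : {p : ℕ+ × ℕ+ | p.1 < p.2 ∧ (v * τ) p.2 < (v * τ) p.1} =
      insert (a, b) (φ '' {p : ℕ+ × ℕ+ | p.1 < p.2 ∧ v p.2 < v p.1}) := by
    ext ⟨x, y⟩
    simp only [Set.mem_ofPred_eq, Set.mem_insert_iff, Set.mem_image, Equiv.Perm.mul_apply]
    constructor
    · rintro ⟨hxy, hw⟩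
      by_cases h : (x, y) = (a, b)
      · exact Or.inl h
      refine Or.inr ⟨φ (x, y), ?_, hφφ _ hxy⟩
      by_cases h' : τ x < τ y
      · simpa [φ, h'] using hw
      · simp only [φ, h', if_false]
        refine ⟨hxy, ?_⟩
        have := hinj y a
        have := hinj b x
        have := lt_trichotomy (v y) (v a)
        have := lt_trichotomy (v b) (v x)
        have := hcov x
        have := hcov y
        simp only [Prod.mk.injEq] at h
        rw [hτ x, hτ y] at hw h'
        grind
    · rintro (h | ⟨⟨x', y'⟩, ⟨hxy, hw⟩, h⟩)
      · obtain ⟨rfl, rfl⟩ := Prod.mk.inj h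
        exact ⟨hab, by simpa [τ] using hlt⟩
      · by_cases h' : τ x' < τ y'
        · simp only [φ, h', if_true, Prod.mk.injEq] at h
          obtain ⟨rfl, rfl⟩ := h
          exact ⟨h', by simpa only [hττ] using hw⟩
        · simp only [φ, h', if_false, Prod.mk.injEq] at h
          obtain ⟨rfl, rfl⟩ := h
          refine ⟨hxy, ?_⟩
          rw [hτ x', hτ y'] at h' ⊢
          grind
  have hnot : (a, b) ∉ φ '' {p : ℕ+ × ℕ+ | p.1 < p.2 ∧ v p.2 < v p.1} := by
    rintro ⟨p, ⟨hp, hvp⟩, h⟩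
    have h2 := hφφ p hp
    rw [h] at h2
    have : φ (a, b) = (a, b) := by simp [φ, τ, hab.le]
    rw [this] at h2
    subst h2
    exact lt_asymm hlt hvp
  have hcard : (φ '' {p : ℕ+ × ℕ+ | p.1 < p.2 ∧ v p.2 < v p.1}).ncard = len v := by
    refine Set.InjOn.ncard_image fun p hp q hq h => ?_
    rw [← hφφ p hp.1, ← hφφ q hq.1, h]
  unfold len
  rw [hset, Set.ncard_insert_of_notMem hnot (hv.finite_inversions_s8.image φ), hcard]
  rfl

/-- If some position carries a `u`-value below `β` and a `w`-value at least `β`, then the opposite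
crossing occurs at some other position. -/
theorem exists_crossing (u w : Equiv.Perm ℕ+) {a β : ℕ+} (hu : u a < β) (hw : β ≤ w a) :
    ∃ b, w b < β ∧ β ≤ u b := by
  by_contra! h
  have key : ∀ v : Equiv.Perm ℕ+, v ⁻¹' Set.Iio β = v.symm '' Set.Iio β := fun v =>
    (Equiv.image_symm_eq_preimage v _).symm
  have hcard : ∀ v : Equiv.Perm ℕ+, (v ⁻¹' Set.Iio β).ncard = (Set.Iio β).ncard := fun v => by
    rw [key, Set.ncard_image_of_injective _ v.symm.injective]
  have heq : w ⁻¹' Set.Iio β = u ⁻¹' Set.Iio β :=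
    Set.eq_of_subset_of_ncard_le (fun b hb => h b hb) (by rw [hcard, hcard])
      (by rw [key]; exact (Set.finite_Iio β).image _)
  have ha : a ∈ w ⁻¹' Set.Iio β := heq ▸ (show a ∈ u ⁻¹' Set.Iio β from hu)
  exact absurd ha (not_lt.2 hw)

/-- Sufficient criterion for comparability in the `k`-Bruhat order: `w` is pointwise above `u` on
the first `k` positions and below `u` on the others, and no inversion of `w` within either block is
a non-inversion of `u`. -/
theorem kBruhat_of_le {k : ℕ+} {u w : Equiv.Perm ℕ+} (hu : FinSupp u) (hw : FinSupp w)
    (hle : ∀ a, a ≤ k → u a ≤ w a) (hge : ∀ b, k < b → w b ≤ u b)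
    (hlow : ∀ x y, x < y → y ≤ k → u x < u y → w x < w y)
    (hhigh : ∀ x y, x < y → k < x → u x < u y → w x < w y) :
    kBruhat k u w := by
  induction hn : len w using Nat.strong_induction_on generalizing w with
  | _ n ih =>
  by_cases huw : u = w
  · exact huw ▸ Relation.ReflTransGen.refl
  obtain ⟨a, ha, hamin⟩ := Set.exists_min_image _ u (hu.finite_ne hw) (by
    by_contra h
    rw [Set.not_nonempty_iff_eq_empty, Set.eq_empty_iff_forall_notMem] at h
    exact huw (Equiv.ext fun x => not_not.1 (h x)))
  have hsmall : ∀ x, u x < u a → w x = u x := fun x hx => by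
    by_contra h
    exact absurd (hamin x (Ne.symm h)) (not_le.2 hx)
  have hsmall' : ∀ y, w y < u a → u y = w y := fun y hy => by
    have h1 := hsmall (u.symm (w y)) (by simpa using hy)
    have h2 : u.symm (w y) = y := w.injective (by simpa using h1)
    rw [← h2]
    simpa using h1.symm
  have haw : u a < w a :=
    lt_of_le_of_ne (not_lt.1 fun h => ha (hsmall' a h)) ha
  have hak : a ≤ k := not_lt.1 fun h => absurd (hge a h) (not_le.2 haw)
  obtain ⟨b, ⟨hbw, hbu⟩, hbmax⟩ := Set.exists_max_image {b | w b < w a ∧ w a ≤ u b} u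
    ((hu.finite_ne hw).subset fun b hb => (hb.1.trans_le hb.2).ne')
    (exists_crossing u w haw le_rfl)
  have hkb : k < b := not_le.1 fun h => absurd (hle b h) (not_le.2 (hbw.trans_le hbu))
  have hab : a < b := hak.trans_lt hkb
  have hub : u a ≤ w b := not_lt.1 fun h =>
    absurd (hsmall' b h) (hbw.trans_le hbu).ne'
  have hmax : ∀ c, w c < w a → u b < u c → False := fun c hc hbc =>
    absurd (hbmax c ⟨hc, hbu.trans hbc.le⟩) (not_le.2 hbc)
  let v := w * Equiv.swap a b
  have hva : v a = w b := by simp [v]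
  have hvb : v b = w a := by simp [v]
  have hv : ∀ c, c ≠ a → c ≠ b → v c = w c := fun c h1 h2 => by
    simp [v, Equiv.swap_apply_of_ne_of_ne h1 h2]
  have hvfin : FinSupp v := hw.mul (FinSupp.swap a b)
  have hwv : w = v * Equiv.swap a b := by simp [v, mul_assoc]
  have hlen : len w = len v + 1 := by
    conv_lhs => rw [hwv]
    refine len_mul_swap hvfin hab (by rwa [hva, hvb]) fun c hac hcb => ?_
    rw [hva, hvb, hv c hac.ne' hcb.ne]
    rintro ⟨h1, h2⟩
    rcases le_or_gt c k with hck | hkc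
    · have huc : u c < u a := by
        refine lt_of_le_of_ne (not_lt.1 fun h => ?_) (u.injective.ne hac.ne')
        exact lt_asymm h2 (hlow a c hac hck h)
      exact absurd (hub.trans_lt h1) (not_lt.2 ((hsmall c huc).trans_lt huc).le)
    · refine hmax c h2 (lt_of_le_of_ne (not_lt.1 fun h => ?_) (u.injective.ne hcb.ne'))
      exact lt_asymm h1 (hhigh c b hcb hkc h)
  refine Relation.ReflTransGen.tail
    (ih (len v) (by omega) hvfin ?_ ?_ ?_ ?_ rfl) ⟨a, b, hak, hkb, hwv, hlen⟩
  · intro c hc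
    by_cases hca : c = a
    · rw [hca, hva]; exact hub
    · rw [hv c hca (hc.trans_lt hkb).ne]; exact hle c hc
  · intro c hc
    by_cases hcb : c = b
    · rw [hcb, hvb]; exact hbu
    · rw [hv c (hak.trans_lt hc).ne' hcb]; exact hge c hc
  · intro x y hxy hyk huxy
    have hxb := (hxy.trans_le hyk).trans hkb |>.ne
    have hyb := (hyk.trans_lt hkb).ne
    have := hlow x y hxy hyk huxy
    by_cases hx : x = a
    · rw [hx, hva, hv y (hx ▸ hxy.ne') hyb]
      exact hbw.trans (hx ▸ this)
    · by_cases hy : y = a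
      · rw [hy, hva, hv x hx hxb, hsmall x (hy ▸ huxy)]
        exact (hy ▸ huxy).trans_le hub
      · rwa [hv x hx hxb, hv y hy hyb]
  · intro x y hxy hkx huxy
    have hxa := (hak.trans_lt hkx).ne'
    have hya := (hak.trans_lt (hkx.trans hxy)).ne'
    have := hhigh x y hxy hkx huxy
    by_cases hx : x = b
    · subst hx
      rw [hvb, hv y hya hxy.ne']
      exact lt_of_le_of_ne (not_lt.1 fun h => hmax y h huxy) (w.injective.ne hya.symm)
    · by_cases hy : y = b
      · subst hy
        rw [hvb, hv x hxa hx]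
        exact this.trans hbw
      · rwa [hv x hxa hx, hv y hya hy]

theorem bijective_of_injective_of_eventually_fixed {f : ℕ+ → ℕ+} (hf : Function.Injective f) {N : ℕ+}
    (hN : ∀ x, N < x → f x = x) : Function.Bijective f := by
  refine ⟨hf, fun y => ?_⟩
  rcases lt_or_ge N y with hy | hy
  · exact ⟨y, hN y hy⟩
  have hmaps : Set.MapsTo f (Set.Iic N) (Set.Iic N) := fun x hx => by
    by_contra h
    rw [Set.mem_Iic, not_le] at h
    have := hf (hN (f x) h)
    rw [this] at h
    exact absurd hx (not_le.2 h)
  have := ((Set.finite_Iic N).injOn_iff_bijOn_of_mapsTo hmaps).1 hf.injOn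
  obtain ⟨x, -, hx⟩ := this.surjOn hy
  exact ⟨x, hx⟩

/-- A nonempty finite set of values can be placed in the first positions so that the permutation
increases there and also increases on the remaining positions. -/
theorem exists_grassmannian (T : Finset ℕ+) (hT : T.Nonempty) :
    ∃ (w : Equiv.Perm ℕ+) (k : ℕ+), FinSupp w ∧ (∀ x, x ≤ k ↔ w x ∈ T) ∧
      (∀ x y, x < y → y ≤ k → w x < w y) ∧ (∀ x y, x < y → k < x → w x < w y) := by
  let g : ℕ+ → ℕ := fun t => if t ∈ T then (T.filter (· ≤ t)).card
    else t + (T.filter (t < ·)).card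
  have hsplit : ∀ t, (T.filter (· ≤ t)).card + (T.filter (t < ·)).card = T.card := fun t => by
    rw [← T.card_filter_add_card_filter_not (· ≤ t)]
    simp only [not_le]
  have hg1 : ∀ t ∈ T, g t = (T.filter (· ≤ t)).card := fun t ht => if_pos ht
  have hg2 : ∀ t ∉ T, g t = t + (T.filter (t < ·)).card := fun t ht => if_neg ht
  have hbelow : ∀ t ∉ T, (T.filter (· ≤ t)).card < t := fun t ht => by
    have : T.filter (· ≤ t) ⊆ Finset.Ico 1 t := fun s hs => by
      rw [Finset.mem_filter] at hs
      exact Finset.mem_Ico.2 ⟨one_le, lt_of_le_of_ne hs.2 fun h => ht (h ▸ hs.1)⟩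
    have := Finset.card_le_card this
    rw [PNat.card_Ico] at this
    have := t.pos
    simp only [PNat.one_coe] at *
    omega
  have hle : ∀ t, g t ≤ T.card ↔ t ∈ T := fun t => by
    constructor
    · intro h
      by_contra ht
      have := hsplit t
      have := hbelow t ht
      rw [hg2 t ht] at h
      omega
    · intro ht
      rw [hg1 t ht]
      exact Finset.card_filter_le _ _
  have hmono1 : ∀ s ∈ T, ∀ t ∈ T, s < t → g s < g t := fun s hs t ht hst => by
    rw [hg1 s hs, hg1 t ht]
    refine Finset.card_lt_card (Finset.ssubset_iff_of_subset
      (Finset.monotone_filter_right T fun x _ hx => hx.trans hst.le) |>.2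
      ⟨t, by simp [ht], by simp [hst]⟩)
  have hmono2 : ∀ s ∉ T, ∀ t ∉ T, s < t → g s < g t := fun s hs t ht hst => by
    rw [hg2 s hs, hg2 t ht]
    have hsub : T.filter (s < ·) ⊆ T.filter (t < ·) ∪ Finset.Ioo s t := fun x hx => by
      simp only [Finset.mem_filter, Finset.mem_union, Finset.mem_Ioo] at hx ⊢
      rcases lt_trichotomy x t with h | h | h
      · exact Or.inr ⟨hx.2, h⟩
      · exact absurd (h ▸ hx.1) ht
      · exact Or.inl ⟨hx.1, h⟩
    have := (Finset.card_le_card hsub).trans (Finset.card_union_le _ _)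
    rw [PNat.card_Ioo] at this
    have : (s : ℕ) < t := hst
    omega
  have hinj : Function.Injective g := fun s t hst => by
    have hiff : s ∈ T ↔ t ∈ T := by rw [← hle, ← hle, hst]
    by_contra hne
    by_cases hs : s ∈ T
    · rcases lt_or_gt_of_ne hne with h | h
      · exact (hmono1 s hs t (hiff.1 hs) h).ne hst
      · exact (hmono1 t (hiff.1 hs) s hs h).ne' hst
    · have ht : t ∉ T := fun h => hs (hiff.2 h)
      rcases lt_or_gt_of_ne hne with h | h
      · exact (hmono2 s hs t ht h).ne hst
      · exact (hmono2 t ht s hs h).ne' hst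
  have hpos : ∀ t, 0 < g t := fun t => by
    by_cases ht : t ∈ T
    · rw [hg1 t ht]
      exact Finset.card_pos.2 ⟨t, by simp [ht]⟩
    · rw [hg2 t ht]
      exact Nat.add_pos_left t.pos _
  let f : ℕ+ → ℕ+ := fun t => ⟨g t, hpos t⟩
  have hfinj : Function.Injective f := fun s t h => hinj (congrArg PNat.val h)
  have hffix : ∀ t, T.max' hT < t → f t = t := fun t ht => by
    have hT' : ∀ s ∈ T, s < t := fun s hs => (T.le_max' s hs).trans_lt ht
    apply PNat.eq
    change g t = t
    rw [hg2 t fun h => lt_irrefl t (hT' t h), Finset.filter_eq_empty_iff.2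
      fun s hs => (hT' s hs).not_gt]
    simp
  let e := Equiv.ofBijective f (bijective_of_injective_of_eventually_fixed hfinj hffix)
  have hk : ∀ x, x ≤ (⟨T.card, hT.card_pos⟩ : ℕ+) ↔ e⁻¹ x ∈ T := fun x => by
    rw [← hle]
    have : (g (e⁻¹ x) : ℕ) = x := congrArg PNat.val (e.apply_symm_apply x)
    rw [this]
    rfl
  have hlt : ∀ s t, g s < g t ↔ e s < e t := fun s t => Iff.rfl
  have hmono : ∀ x y, x < y → (e⁻¹ x ∈ T ↔ e⁻¹ y ∈ T) → e⁻¹ x < e⁻¹ y := by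
    intro x y hxy hiff
    have hxy' : g (e⁻¹ x) < g (e⁻¹ y) := by
      rw [hlt]
      simpa using hxy
    refine lt_of_le_of_ne (not_lt.1 fun h => ?_) fun h => ?_
    · by_cases hx : e⁻¹ x ∈ T
      · exact lt_asymm hxy' (hmono1 _ (hiff.1 hx) _ hx h)
      · exact lt_asymm hxy' (hmono2 _ (fun hy => hx (hiff.2 hy)) _ hx h)
    · exact (h ▸ hxy').false
  refine ⟨e⁻¹, _, FinSupp.inv ?_, hk, fun x y hxy hy => ?_, fun x y hxy hx => ?_⟩
  · refine (Set.finite_Iic (T.max' hT)).subset fun x hx => ?_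
    by_contra h
    exact hx (hffix x (not_le.1 h))
  · exact hmono x y hxy (iff_of_true ((hk x).1 (hxy.le.trans hy)) ((hk y).1 hy))
  · refine hmono x y hxy (iff_of_false ?_ ?_)
    · exact fun h => absurd ((hk x).2 h) (not_le.2 hx)
    · exact fun h => absurd ((hk y).2 h) (not_le.2 (hx.trans hxy))

/-- For every `ζ ∈ S_∞` there are `u ∈ S_∞` and `k` with `u ≤_k ζu`. -/
theorem stmt_8 (ζ : Equiv.Perm ℕ+) (hζ : FinSupp ζ) :
    ∃ (u : Equiv.Perm ℕ+) (k : ℕ+), FinSupp u ∧ kBruhat k u (ζ * u) := by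
  have hfin : {t | ζ⁻¹ t < t}.Finite := hζ.inv.subset fun t ht => (show ζ⁻¹ t < t from ht).ne
  rcases hfin.toFinset.eq_empty_or_nonempty with hempty | hT
  · have hle : ∀ t, t ≤ ζ⁻¹ t := fun t => not_lt.1 fun h =>
      Finset.notMem_empty t (hempty ▸ hfin.mem_toFinset.2 h)
    have hone : ∀ t, ζ⁻¹ t = t := fun t => by
      by_contra h
      obtain ⟨b, hb, hb'⟩ := exists_crossing 1 ζ⁻¹ (a := t) (lt_of_le_of_ne (hle t) (Ne.symm h))
        le_rfl
      exact absurd (hle b) (not_le.2 (hb.trans_le hb'))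
    have : ζ = 1 := inv_eq_one.1 (Equiv.ext hone)
    refine ⟨1, 1, by simp [FinSupp], ?_⟩
    rw [this, mul_one]
    exact Relation.ReflTransGen.refl
  obtain ⟨w, k, hw, hk, hlow, hhigh⟩ := exists_grassmannian _ hT
  have hu : FinSupp (ζ⁻¹ * w) := hζ.inv.mul hw
  refine ⟨ζ⁻¹ * w, k, hu, ?_⟩
  rw [mul_inv_cancel_left]
  refine kBruhat_of_le hu hw (fun a ha => ?_) (fun b hb => ?_)
    (fun x y hxy hy _ => hlow x y hxy hy) (fun x y hxy hx _ => hhigh x y hxy hx)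
  · exact (hfin.mem_toFinset.1 ((hk a).1 ha)).le
  · exact not_lt.1 fun h => absurd ((hk b).2 (hfin.mem_toFinset.2 h)) (not_le.2 hb)
end
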